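/- arXiv:2307.06092 — 2 statements merged into one kernel-verified Lean document; each statement's English description precedes it below -/
import Mathlib

section
/- Let F be centered with variance σ² = E[A], where conditionally on A ≥ 0 the variable F is centered Gaussian with variance A. Let Z ~ N(0, σ²). Then |E[cos F] − E[cos Z]| = |E[e^{−A/2} − e^{−σ²/2}]|, and consequently both 2·d_TV(F,Z) and W₁(F,Z) are bounded below by |E[e^{−A/2} − e^{−σ²/2}]|. -/
open MeasureTheory ProbabilityTheory

/-- Total variation distance between two measures on `ℝ`. -/
noncomputable def dTV (μ ν : Measure ℝ) : ℝ :=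
  ⨆ s : {s : Set ℝ // MeasurableSet s}, |(μ s.1).toReal - (ν s.1).toReal|

/-- 1-Wasserstein distance between two measures on `ℝ`. -/
noncomputable def W1 (μ ν : Measure ℝ) : ℝ :=
  sInf {x | ∃ π : Measure (ℝ × ℝ), IsProbabilityMeasure π ∧
    π.map Prod.fst = μ ∧ π.map Prod.snd = ν ∧ x = ∫ p, |p.1 - p.2| ∂π}

theorem abs_measureReal_sub_le_dTV (μ ν : Measure ℝ) [IsProbabilityMeasure μ]
    [IsProbabilityMeasure ν] {s : Set ℝ} (hs : MeasurableSet s) :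
    |μ.real s - ν.real s| ≤ dTV μ ν := by
  refine le_ciSup (f := fun s : {s : Set ℝ // MeasurableSet s} ↦
    |(μ s.1).toReal - (ν s.1).toReal|) ⟨1, ?_⟩ ⟨s, hs⟩
  rintro _ ⟨t, rfl⟩
  exact abs_sub_le_of_nonneg_of_le ENNReal.toReal_nonneg (measureReal_le_one (μ := μ))
    ENNReal.toReal_nonneg (measureReal_le_one (μ := ν))

theorem abs_integral_sub_le_dTV_of_mem_Icc (μ ν : Measure ℝ) [IsProbabilityMeasure μ]
    [IsProbabilityMeasure ν] {g : ℝ → ℝ} (hg : Measurable g) (hg01 : ∀ x, g x ∈ Set.Icc 0 1) :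
    |∫ x, g x ∂μ - ∫ x, g x ∂ν| ≤ dTV μ ν := by
  have h_integrable (ρ : Measure ℝ) [IsProbabilityMeasure ρ] : Integrable g ρ :=
    .of_mem_Icc 0 1 hg.aemeasurable (.of_forall hg01)
  have hlayer (ρ : Measure ℝ) [IsProbabilityMeasure ρ] :
      ∫ x, g x ∂ρ = ∫ t in Set.Ioc 0 1, ρ.real {x | t ≤ g x} :=
    (h_integrable ρ).integral_eq_integral_Ioc_meas_le (.of_forall fun x ↦ (hg01 x).1)
      (.of_forall fun x ↦ (hg01 x).2)
  have hlevel (ρ : Measure ℝ) [IsProbabilityMeasure ρ] :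
      IntegrableOn (fun t ↦ ρ.real {x | t ≤ g x}) (Set.Ioc 0 1) := by
    have hanti : Antitone fun t ↦ ρ.real {x | t ≤ g x} := fun s t hst ↦
      measureReal_mono fun x (hx : t ≤ g x) ↦ hst.trans hx
    exact .of_mem_Icc 0 1 hanti.measurable.aemeasurable
      (.of_forall fun t ↦ ⟨measureReal_nonneg, measureReal_le_one⟩)
  rw [hlayer μ, hlayer ν, ← integral_sub (hlevel μ) (hlevel ν), ← Real.norm_eq_abs]
  refine (norm_setIntegral_le_of_norm_le_const (by simp) fun t _ ↦
    abs_measureReal_sub_le_dTV μ ν (measurableSet_le measurable_const hg)).trans ?_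
  simp

theorem abs_integral_sub_le_two_mul_dTV (μ ν : Measure ℝ) [IsProbabilityMeasure μ]
    [IsProbabilityMeasure ν] {h : ℝ → ℝ} (hh : Measurable h) (hbound : ∀ x, |h x| ≤ 1) :
    |∫ x, h x ∂μ - ∫ x, h x ∂ν| ≤ 2 * dTV μ ν := by
  have hrescale (ρ : Measure ℝ) [IsProbabilityMeasure ρ] :
      ∫ x, (h x + 1) / 2 ∂ρ = (∫ x, h x ∂ρ + 1) / 2 := by
    have h_integrable : Integrable h ρ := .of_mem_Icc (-1) 1 hh.aemeasurable
      (.of_forall fun x ↦ abs_le.1 (hbound x))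
    rw [integral_div, integral_add h_integrable (integrable_const 1)]
    simp
  have key := abs_integral_sub_le_dTV_of_mem_Icc μ ν (g := fun x ↦ (h x + 1) / 2)
    ((hh.add_const 1).div_const 2) fun x ↦ by
      have := abs_le.1 (hbound x)
      exact ⟨by linarith, by linarith⟩
  rw [hrescale μ, hrescale ν, ← sub_div, add_sub_add_right_eq_sub, abs_div,
    abs_of_pos (two_pos : (0 : ℝ) < 2)] at key
  linarith

theorem abs_integral_sub_le_W1 (μ ν : Measure ℝ) [IsProbabilityMeasure μ]
    [IsProbabilityMeasure ν] (hμ : Integrable id μ) (hν : Integrable id ν) {h : ℝ → ℝ}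
    (hh : LipschitzWith 1 h) :
    |∫ x, h x ∂μ - ∫ x, h x ∂ν| ≤ W1 μ ν := by
  refine le_csInf ⟨_, μ.prod ν, inferInstance, by simp, by simp, rfl⟩ ?_
  rintro _ ⟨π, hπ, hfst, hsnd, rfl⟩
  have hlip (x y : ℝ) : |h x - h y| ≤ |x - y| := by
    simpa [Real.dist_eq] using hh.dist_le_mul x y
  have h_integrable (ρ : Measure ℝ) [IsProbabilityMeasure ρ] (hρ : Integrable id ρ) :
      Integrable h ρ := by
    refine (hρ.norm.add (integrable_const |h 0|)).mono' hh.continuous.aestronglyMeasurable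
      (.of_forall fun x ↦ ?_)
    have := hlip x 0
    rw [sub_zero] at this
    have := abs_sub_abs_le_abs_sub (h x) (h 0)
    simp only [Pi.add_apply, id, Real.norm_eq_abs]
    linarith
  have hmeas : Measurable h := hh.continuous.measurable
  have hid₁ : Integrable (fun p : ℝ × ℝ ↦ p.1) π :=
    (integrable_map_measure (g := id) (by fun_prop) (by fun_prop)).1 (hfst ▸ hμ)
  have hid₂ : Integrable (fun p : ℝ × ℝ ↦ p.2) π :=
    (integrable_map_measure (g := id) (by fun_prop) (by fun_prop)).1 (hsnd ▸ hν)
  have hh₁ : Integrable (fun p : ℝ × ℝ ↦ h p.1) π :=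
    (integrable_map_measure (g := h) hmeas.aestronglyMeasurable (by fun_prop)).1
      (hfst ▸ h_integrable μ hμ)
  have hh₂ : Integrable (fun p : ℝ × ℝ ↦ h p.2) π :=
    (integrable_map_measure (g := h) hmeas.aestronglyMeasurable (by fun_prop)).1
      (hsnd ▸ h_integrable ν hν)
  have e₁ : ∫ x, h x ∂μ = ∫ p, h p.1 ∂π := by
    rw [← hfst, integral_map (by fun_prop) hmeas.aestronglyMeasurable]
  have e₂ : ∫ x, h x ∂ν = ∫ p, h p.2 ∂π := by
    rw [← hsnd, integral_map (by fun_prop) hmeas.aestronglyMeasurable]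
  rw [e₁, e₂, ← integral_sub hh₁ hh₂]
  exact abs_integral_le_integral_abs.trans
    (integral_mono (hh₁.sub hh₂).abs (hid₁.sub hid₂).abs fun p ↦ hlip p.1 p.2)

theorem gaussianReal_toNNReal_eq_map_sqrt_mul (a : ℝ) :
    gaussianReal 0 a.toNNReal = (gaussianReal 0 1).map (√a * ·) := by
  rw [gaussianReal_map_const_mul, mul_zero, mul_one]
  congr 1
  ext
  rcases le_total 0 a with h | h <;> simp [h, Real.sqrt_eq_zero_of_nonpos]

theorem measurable_map_prodMk_gaussianReal_toNNReal :
    Measurable fun a : ℝ ↦ (gaussianReal 0 a.toNNReal).map (fun x ↦ (a, x)) := by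
  refine Measure.measurable_of_measurable_coe _ fun s hs ↦ ?_
  have hscale : Measurable fun p : ℝ × ℝ ↦ (p.1, √p.1 * p.2) := by fun_prop
  convert measurable_measure_prodMk_left (ν := gaussianReal 0 1) (hscale hs) using 2 with a
  rw [gaussianReal_toNNReal_eq_map_sqrt_mul, Measure.map_map (by fun_prop) (by fun_prop),
    Measure.map_apply (by fun_prop) hs]
  rfl

theorem map_snd_bind_gaussianReal_toNNReal (ρ : Measure ℝ) [SFinite ρ] :
    (ρ.bind fun a ↦ (gaussianReal 0 a.toNNReal).map (fun x ↦ (a, x))).map Prod.snd =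
      (ρ.prod (gaussianReal 0 1)).map (fun p ↦ √p.1 * p.2) := by
  ext s hs
  have hscale : Measurable fun p : ℝ × ℝ ↦ √p.1 * p.2 := by fun_prop
  rw [Measure.map_apply measurable_snd hs, Measure.bind_apply (measurable_snd hs)
    measurable_map_prodMk_gaussianReal_toNNReal.aemeasurable, Measure.map_apply hscale hs,
    Measure.prod_apply (hscale hs)]
  refine lintegral_congr fun a ↦ ?_
  rw [gaussianReal_toNNReal_eq_map_sqrt_mul, Measure.map_map (by fun_prop) (by fun_prop),
    Measure.map_apply (by fun_prop) (measurable_snd hs)]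
  rfl

theorem integral_cos_mul_gaussianReal (c : ℝ) :
    ∫ x, Real.cos (c * x) ∂(gaussianReal 0 1) = Real.exp (-c ^ 2 / 2) := by
  have h := charFun_gaussianReal (μ := 0) (v := 1) c
  rw [charFun_apply_real] at h
  have h_integrable :
      Integrable (fun x : ℝ ↦ Complex.exp (c * x * Complex.I)) (gaussianReal 0 1) := by
    refine .of_bound (by fun_prop) 1 (.of_forall fun x ↦ ?_)
    rw [← Complex.ofReal_mul, Complex.norm_exp_ofReal_mul_I]
  have hre := Complex.reCLM.integral_comp_comm h_integrable
  rw [h] at hre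
  have hcos (x : ℝ) : Complex.reCLM (Complex.exp (c * x * Complex.I)) = Real.cos (c * x) := by
    rw [← Complex.ofReal_mul, Complex.reCLM_apply, Complex.exp_ofReal_mul_I_re]
  simp only [hcos] at hre
  rw [hre, Complex.reCLM_apply, ← Complex.exp_ofReal_re]
  congr 2
  push_cast
  ring

theorem integral_cos_gaussianReal_toNNReal {a : ℝ} (ha : 0 ≤ a) :
    ∫ x, Real.cos x ∂(gaussianReal 0 a.toNNReal) = Real.exp (-a / 2) := by
  rw [gaussianReal_toNNReal_eq_map_sqrt_mul, integral_map (by fun_prop) (by fun_prop),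
    integral_cos_mul_gaussianReal, Real.sq_sqrt ha]

/-- **Cosine lower bound for Gaussian variance mixtures.**
If conditionally on `A ≥ 0` the variable `F` is centered Gaussian with variance `A`,
`σ² = E[A]` and `Z ~ N(0, σ²)`, then
`|E[cos F] − E[cos Z]| = |E[e^{−A/2} − e^{−σ²/2}]|`, and this quantity bounds
both `2·d_TV(F,Z)` and `W₁(F,Z)` from below. -/
theorem cos_lower_bound_gaussian_mixture
    {Ω : Type*} [MeasurableSpace Ω] (P : Measure Ω) [IsProbabilityMeasure P]
    (F A : Ω → ℝ) (hFmeas : Measurable F) (hAmeas : Measurable A)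
    (hApos : ∀ ω, 0 ≤ A ω) (hAint : Integrable A P)
    (hcond : P.map (fun ω => (A ω, F ω)) =
      (P.map A).bind (fun a => (gaussianReal 0 (Real.toNNReal a)).map (fun x => (a, x)))) :
    |(∫ ω, Real.cos (F ω) ∂P) -
        ∫ x, Real.cos x ∂(gaussianReal 0 (Real.toNNReal (∫ ω, A ω ∂P)))| =
      |∫ ω, (Real.exp (-(A ω) / 2) - Real.exp (-(∫ ω', A ω' ∂P) / 2)) ∂P| ∧
    |∫ ω, (Real.exp (-(A ω) / 2) - Real.exp (-(∫ ω', A ω' ∂P) / 2)) ∂P| ≤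
      2 * dTV (P.map F) (gaussianReal 0 (Real.toNNReal (∫ ω, A ω ∂P))) ∧
    |∫ ω, (Real.exp (-(A ω) / 2) - Real.exp (-(∫ ω', A ω' ∂P) / 2)) ∂P| ≤
      W1 (P.map F) (gaussianReal 0 (Real.toNNReal (∫ ω, A ω ∂P))) := by
  have hlaw : P.map F =
      ((P.map A).prod (gaussianReal 0 1)).map (fun p ↦ √p.1 * p.2) := by
    rw [← map_snd_bind_gaussianReal_toNNReal, ← hcond,
      Measure.map_map measurable_snd (by fun_prop)]
    rfl
  have : IsProbabilityMeasure (P.map A) := Measure.isProbabilityMeasure_map hAmeas.aemeasurable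
  have : IsProbabilityMeasure (P.map F) := Measure.isProbabilityMeasure_map hFmeas.aemeasurable
  have hvar : 0 ≤ ∫ ω, A ω ∂P := integral_nonneg hApos
  have hcosF : ∫ x, Real.cos x ∂(P.map F) = ∫ ω, Real.exp (-(A ω) / 2) ∂P := by
    rw [hlaw, integral_map (by fun_prop) (by fun_prop), integral_prod]
    · simp only [integral_cos_mul_gaussianReal]
      rw [integral_map hAmeas.aemeasurable (by fun_prop)]
      simp only [Real.sq_sqrt (hApos _)]
    · exact .of_bound (by fun_prop) 1 (.of_forall fun p ↦ Real.abs_cos_le_one _)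
  have hexp : Integrable (fun ω ↦ Real.exp (-(A ω) / 2)) P :=
    .of_mem_Icc 0 1 (by fun_prop) (.of_forall fun ω ↦
      ⟨(Real.exp_pos _).le, Real.exp_le_one_iff.2 (by linarith [hApos ω])⟩)
  have hdiff : (∫ x, Real.cos x ∂(P.map F)) -
      ∫ x, Real.cos x ∂(gaussianReal 0 (Real.toNNReal (∫ ω, A ω ∂P))) =
      ∫ ω, (Real.exp (-(A ω) / 2) - Real.exp (-(∫ ω', A ω' ∂P) / 2)) ∂P := by
    rw [hcosF, integral_cos_gaussianReal_toNNReal hvar,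
      integral_sub hexp (integrable_const _)]
    simp
  have hsqrt : Integrable (fun a ↦ √a) (P.map A) := by
    refine (integrable_map_measure (by fun_prop) hAmeas.aemeasurable).2 ?_
    refine (hAint.add (integrable_const 1)).mono' (by fun_prop) (.of_forall fun ω ↦ ?_)
    have := Real.sq_sqrt (hApos ω)
    simp only [Function.comp_apply, Pi.add_apply, Real.norm_eq_abs,
      abs_of_nonneg (Real.sqrt_nonneg _)]
    nlinarith [sq_nonneg (√(A ω) - 1)]
  have hgauss (v : NNReal) : Integrable id (gaussianReal 0 v) :=
    memLp_one_iff_integrable.1 (memLp_id_gaussianReal 1)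
  have hF : Integrable id (P.map F) := by
    rw [hlaw]
    exact (integrable_map_measure (by fun_prop) (by fun_prop)).2 (hsqrt.mul_prod (hgauss 1))
  rw [← hdiff]
  refine ⟨?_, abs_integral_sub_le_two_mul_dTV _ _ Real.measurable_cos Real.abs_cos_le_one,
    abs_integral_sub_le_W1 _ _ hF (hgauss _) Real.lipschitzWith_cos⟩
  rw [integral_map hFmeas.aemeasurable (by fun_prop)]
end

section
/- Let K be a real separable Hilbert space, X, Y be K-valued random elements, and U a random element on the same probability space as X with values in a Polish space 𝒰. Then for every q ≥ 1 there exists a version of the conditional distribution P_{X|U} such that W_q(X, Y)^q ≤ ∫_𝒰 W_q(P_{X|U=u}, P_Y)^q dP_U(u). -/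
open MeasureTheory ProbabilityTheory

/-- The `q`-th power of the `q`-Wasserstein distance between measures on a Hilbert space `K`:
the infimum of `E[‖T − S‖^q]` over couplings. -/
noncomputable def WqPow {K : Type*} [NormedAddCommGroup K] [InnerProductSpace ℝ K]
    [MeasurableSpace K] (q : ℝ) (μ ν : Measure K) : ℝ :=
  sInf {x | ∃ π : Measure (K × K), IsProbabilityMeasure π ∧
    π.map Prod.fst = μ ∧ π.map Prod.snd = ν ∧ x = ∫ p, ‖p.1 - p.2‖ ^ q ∂π}

section ConvexOnSimplex

open Filter Topology

variable {ι : Type*} [Fintype ι] {F : (ι → ℝ) → ℝ}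

/-- A nonnegative convex function on the standard simplex is bounded by the sum of its values at
the vertices. -/
lemma ConvexOn.le_sum_single_of_mem_stdSimplex [DecidableEq ι]
    (hF : ConvexOn ℝ (stdSimplex ℝ ι) F)
    (hF0 : ∀ w, 0 ≤ F w) {w : ι → ℝ} (hw : w ∈ stdSimplex ℝ ι) :
    F w ≤ ∑ i, F (Pi.single i 1) := by
  have h := hF.map_sum_le (t := Finset.univ) (w := w) (p := fun i => Pi.single i 1)
    (fun i _ => hw.1 i) hw.2 (fun i _ => single_mem_stdSimplex ℝ i)
  have hsum : ∑ i, w i • (Pi.single i 1 : ι → ℝ) = w := by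
    ext j
    simp [Finset.sum_apply, Pi.single_apply]
  rw [hsum] at h
  refine h.trans (Finset.sum_le_sum fun i _ => ?_)
  have hi : w i ≤ 1 := hw.2 ▸ Finset.single_le_sum (fun j _ => hw.1 j) (Finset.mem_univ i)
  exact mul_le_of_le_one_left (hF0 _) hi

/-- If `w` dominates `(1 - η) • v` in the simplex, then `w` is a convex combination of `v` (with
weight `1 - η`) and another point of the simplex. -/
lemma ConvexOn.le_of_smul_le_of_mem_stdSimplex (hF : ConvexOn ℝ (stdSimplex ℝ ι) F) {M : ℝ}
    (hM : ∀ w ∈ stdSimplex ℝ ι, F w ≤ M) {v w : ι → ℝ} (hv : v ∈ stdSimplex ℝ ι)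
    (hw : w ∈ stdSimplex ℝ ι) {η : ℝ} (h0 : 0 < η) (h1 : η < 1)
    (h : ∀ i, (1 - η) * v i ≤ w i) : F w ≤ (1 - η) * F v + η * M := by
  set r : ι → ℝ := fun i => η⁻¹ * (w i - (1 - η) * v i) with hr
  have hrmem : r ∈ stdSimplex ℝ ι := by
    refine ⟨fun i => mul_nonneg (inv_nonneg.2 h0.le) (sub_nonneg.2 (h i)), ?_⟩
    simp only [hr, ← Finset.mul_sum, Finset.sum_sub_distrib, hv.2, hw.2]
    field_simp
    ring
  have hwr : w = (1 - η) • v + η • r := by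
    ext i
    simp only [hr, Pi.add_apply, Pi.smul_apply, smul_eq_mul]
    field_simp
    ring
  have hc := hF.2 hv hrmem (sub_nonneg.2 h1.le) h0.le (sub_add_cancel 1 η)
  rw [← hwr] at hc
  simp only [smul_eq_mul] at hc
  nlinarith [hM r hrmem]

lemma ConvexOn.upperSemicontinuous_restrict_stdSimplex (hF : ConvexOn ℝ (stdSimplex ℝ ι) F)
    (hF0 : ∀ w, 0 ≤ F w) : UpperSemicontinuous (fun w : stdSimplex ℝ ι => F w) := by
  classical
  intro v c hc
  set M := ∑ i, F (Pi.single i 1)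
  have hη : ∀ᶠ η : ℝ in 𝓝[>] 0, (1 - η) * F v + η * M < c := by
    have : ContinuousAt (fun η : ℝ => (1 - η) * F v + η * M) 0 := by fun_prop
    exact (this.eventually (gt_mem_nhds (by simpa using hc))).filter_mono nhdsWithin_le_nhds
  obtain ⟨η, hηc, h0, h1⟩ := (hη.and (Ioo_mem_nhdsGT (zero_lt_one' ℝ))).exists
  have hev : ∀ i, ∀ᶠ w : stdSimplex ℝ ι in 𝓝 v, (1 - η) * v.1 i ≤ w.1 i := by
    intro i
    rcases (v.2.1 i).eq_or_lt with hi | hi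
    · exact Eventually.of_forall fun w => by simpa [← hi] using w.2.1 i
    · have : ContinuousAt (fun w : stdSimplex ℝ ι => w.1 i) v :=
        ((continuous_apply i).comp continuous_subtype_val).continuousAt
      exact (this.eventually (lt_mem_nhds (by nlinarith))).mono fun w hw => hw.le
  filter_upwards [eventually_all.2 hev] with w hw
  exact (hF.le_of_smul_le_of_mem_stdSimplex
    (fun w hw => hF.le_sum_single_of_mem_stdSimplex hF0 hw) v.2 w.2 h0 h1 hw).trans_lt hηc

lemma ConvexOn.measurable_comp_of_mem_stdSimplex {α : Type*} [MeasurableSpace α]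
    (hF : ConvexOn ℝ (stdSimplex ℝ ι) F) (hF0 : ∀ w, 0 ≤ F w)
    {w : α → ι → ℝ} (hw : Measurable w) (hmem : ∀ a, w a ∈ stdSimplex ℝ ι) :
    Measurable (fun a => F (w a)) :=
  (hF.upperSemicontinuous_restrict_stdSimplex hF0).measurable.comp (hw.subtype_mk (h := hmem))

lemma ConvexOn.integrable_comp_of_mem_stdSimplex {α : Type*} [MeasurableSpace α] {ρ : Measure α}
    [IsFiniteMeasure ρ] (hF : ConvexOn ℝ (stdSimplex ℝ ι) F) (hF0 : ∀ w, 0 ≤ F w)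
    {w : α → ι → ℝ} (hw : Measurable w) (hmem : ∀ a, w a ∈ stdSimplex ℝ ι) :
    Integrable (fun a => F (w a)) ρ := by
  classical
  refine Integrable.of_bound
    (hF.measurable_comp_of_mem_stdSimplex hF0 hw hmem).aestronglyMeasurable
    (∑ i, F (Pi.single i 1)) (Eventually.of_forall fun a => ?_)
  rw [Real.norm_of_nonneg (hF0 _)]
  exact hF.le_sum_single_of_mem_stdSimplex hF0 (hmem a)

/-- Averaging with a fixed point `v` makes a convex function continuous on the face of the simplex
spanned by the support of `v`. -/
lemma ConvexOn.continuousOn_midpoint_stdSimplex (hF : ConvexOn ℝ (stdSimplex ℝ ι) F)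
    (hF0 : ∀ w, 0 ≤ F w) {v : ι → ℝ} (hv : v ∈ stdSimplex ℝ ι) :
    ContinuousOn (fun w => F ((1 / 2 : ℝ) • w + (1 / 2 : ℝ) • v))
      {w | w ∈ stdSimplex ℝ ι ∧ ∀ i, v i = 0 → w i = 0} := by
  classical
  set M := ∑ i, F (Pi.single i 1) with hMdef
  have hM : ∀ w ∈ stdSimplex ℝ ι, F w ≤ M :=
    fun w hw => hF.le_sum_single_of_mem_stdSimplex hF0 hw
  have hM0 : 0 ≤ M := Finset.sum_nonneg fun i _ => hF0 _
  have hmem : ∀ w ∈ stdSimplex ℝ ι, (1 / 2 : ℝ) • w + (1 / 2 : ℝ) • v ∈ stdSimplex ℝ ι :=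
    fun w hw => hF.1 hw hv (by norm_num) (by norm_num) (by norm_num)
  rintro w ⟨hw, hwv⟩
  refine Metric.tendsto_nhds.2 fun ε hε => ?_
  obtain ⟨η, hηε, h0, h1⟩ : ∃ η : ℝ, η * M < ε ∧ 0 < η ∧ η < 1 := by
    have hc : ∀ᶠ η : ℝ in 𝓝[>] 0, η * M < ε := by
      have : ContinuousAt (fun η : ℝ => η * M) 0 := by fun_prop
      exact (this.eventually (gt_mem_nhds (by simpa using hε))).filter_mono nhdsWithin_le_nhds
    exact (hc.and (Ioo_mem_nhdsGT (zero_lt_one' ℝ))).exists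
  have hev : ∀ i, ∀ᶠ u in 𝓝[{w | w ∈ stdSimplex ℝ ι ∧ ∀ i, v i = 0 → w i = 0}] w,
      (1 - η) * (w i + v i) ≤ u i + v i ∧ (1 - η) * (u i + v i) ≤ w i + v i := by
    intro i
    rcases (hv.1 i).eq_or_lt with hi | hi
    · filter_upwards [self_mem_nhdsWithin] with u hu
      simp [hu.2 i hi.symm, hwv i hi.symm, ← hi]
    · refine Filter.Eventually.filter_mono nhdsWithin_le_nhds ?_
      have hpos : 0 < w i + v i := add_pos_of_nonneg_of_pos (hw.1 i) hi
      have hlt : (1 - η) * (w i + v i) < w i + v i := by nlinarith [mul_pos h0 hpos]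
      have c1 : ContinuousAt (fun u : ι → ℝ => u i + v i) w :=
        ((continuous_apply i).add continuous_const).continuousAt
      have c2 : ContinuousAt (fun u : ι → ℝ => (1 - η) * (u i + v i)) w :=
        (continuous_const.mul ((continuous_apply i).add continuous_const)).continuousAt
      filter_upwards [c1.eventually (lt_mem_nhds hlt),
        c2.eventually (gt_mem_nhds hlt)] with u hu1 hu2
      exact ⟨hu1.le, hu2.le⟩
  filter_upwards [eventually_all.2 hev, self_mem_nhdsWithin] with u hu huS
  have key1 := hF.le_of_smul_le_of_mem_stdSimplex hM (hmem w hw) (hmem u huS.1) h0 h1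
    (fun i => by
      simp only [Pi.add_apply, Pi.smul_apply, smul_eq_mul]; linarith [(hu i).1])
  have key2 := hF.le_of_smul_le_of_mem_stdSimplex hM (hmem u huS.1) (hmem w hw) h0 h1
    (fun i => by
      simp only [Pi.add_apply, Pi.smul_apply, smul_eq_mul]; linarith [(hu i).2])
  rw [Real.dist_eq, abs_lt]
  constructor <;> nlinarith [hF0 ((1 / 2 : ℝ) • w + (1 / 2 : ℝ) • v),
    hF0 ((1 / 2 : ℝ) • u + (1 / 2 : ℝ) • v)]

/-- **Jensen's inequality** on the standard simplex, without any continuity assumption. -/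
lemma ConvexOn.map_integral_le_of_mem_stdSimplex {α : Type*} [MeasurableSpace α] {ρ : Measure α}
    [IsProbabilityMeasure ρ] (hF : ConvexOn ℝ (stdSimplex ℝ ι) F) (hF0 : ∀ w, 0 ≤ F w)
    {w : α → ι → ℝ} (hw : Measurable w) (hmem : ∀ a, w a ∈ stdSimplex ℝ ι) :
    F (∫ a, w a ∂ρ) ≤ ∫ a, F (w a) ∂ρ := by
  have hwi : ∀ i, Integrable (fun a => w a i) ρ := fun i => by
    refine Integrable.of_bound (hw.eval (a := i)).aestronglyMeasurable 1
      (Eventually.of_forall fun a => ?_)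
    rw [Real.norm_of_nonneg ((hmem a).1 i), ← (hmem a).2]
    exact Finset.single_le_sum (fun j _ => (hmem a).1 j) (Finset.mem_univ i)
  have hwint : Integrable w ρ := Integrable.of_eval hwi
  set v := ∫ a, w a ∂ρ with hvdef
  have hveval : ∀ i, v i = ∫ a, w a i ∂ρ := fun i => eval_integral hwi i
  have hclosed : IsClosed {w | w ∈ stdSimplex ℝ ι ∧ ∀ i, v i = 0 → w i = 0} := by
    refine (isClosed_stdSimplex ℝ ι).inter ?_
    have : {w : ι → ℝ | ∀ i, v i = 0 → w i = 0} = ⋂ i, ⋂ (_ : v i = 0), {w | w i = 0} := by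
      ext w; simp
    change IsClosed {w : ι → ℝ | ∀ i, v i = 0 → w i = 0}
    rw [this]
    exact isClosed_iInter fun i => isClosed_iInter fun _ =>
      isClosed_eq (continuous_apply i) continuous_const
  have hvmem : v ∈ stdSimplex ℝ ι :=
    (convex_stdSimplex ℝ ι).integral_mem (isClosed_stdSimplex ℝ ι)
      (Eventually.of_forall hmem) hwint
  have hae : ∀ᵐ a ∂ρ, w a ∈ {w | w ∈ stdSimplex ℝ ι ∧ ∀ i, v i = 0 → w i = 0} := by
    have : ∀ i, ∀ᵐ a ∂ρ, v i = 0 → w a i = 0 := by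
      intro i
      by_cases hi : v i = 0
      · rw [hveval, integral_eq_zero_iff_of_nonneg (fun a => (hmem a).1 i) (hwi i)] at hi
        filter_upwards [hi] with a ha _ using ha
      · exact Eventually.of_forall fun a h => absurd h hi
    filter_upwards [ae_all_iff.2 this] with a ha using ⟨hmem a, ha⟩
  have hmid : ∀ x ∈ stdSimplex ℝ ι, (1 / 2 : ℝ) • x + (1 / 2 : ℝ) • v ∈ stdSimplex ℝ ι :=
    fun x hx => hF.1 hx hvmem (by norm_num) (by norm_num) (by norm_num)
  have hint := hF.integrable_comp_of_mem_stdSimplex (ρ := ρ) hF0 hw hmem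
  have hint' := hF.integrable_comp_of_mem_stdSimplex (ρ := ρ) hF0
    (w := fun a => (1 / 2 : ℝ) • w a + (1 / 2 : ℝ) • v) (by fun_prop) fun a => hmid _ (hmem a)
  have hsub : {w | w ∈ stdSimplex ℝ ι ∧ ∀ i, v i = 0 → w i = 0} ⊆ stdSimplex ℝ ι :=
    fun w hw => hw.1
  have hGconv : ConvexOn ℝ {w | w ∈ stdSimplex ℝ ι ∧ ∀ i, v i = 0 → w i = 0}
      (fun w => F ((1 / 2 : ℝ) • w + (1 / 2 : ℝ) • v)) := by
    have hconv : Convex ℝ {w | w ∈ stdSimplex ℝ ι ∧ ∀ i, v i = 0 → w i = 0} := by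
      rintro x ⟨hx, hx'⟩ y ⟨hy, hy'⟩ a b ha hb hab
      exact ⟨convex_stdSimplex ℝ ι hx hy ha hb hab, fun i hi => by simp [hx' i hi, hy' i hi]⟩
    refine ⟨hconv, fun x hx y hy a b ha hb hab => ?_⟩
    have hx' := hmid x hx.1
    have hy' := hmid y hy.1
    have := hF.2 hx' hy' ha hb hab
    convert this using 2
    ext i
    simp only [Pi.add_apply, Pi.smul_apply, smul_eq_mul]
    linear_combination (-(1 / 2 : ℝ) * v i) * hab
  have hJ := hGconv.map_integral_le (hF.continuousOn_midpoint_stdSimplex hF0 hvmem) hclosed hae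
    hwint hint'
  rw [← hvdef, ← add_smul] at hJ
  norm_num at hJ
  have hle : ∫ a, F ((1 / 2 : ℝ) • w a + (1 / 2 : ℝ) • v) ∂ρ
      ≤ ∫ a, ((1 / 2 : ℝ) * F (w a) + (1 / 2 : ℝ) * F v) ∂ρ := by
    refine integral_mono hint' ((hint.const_mul _).add (integrable_const _)) fun a => ?_
    exact hF.2 (hmem a) hvmem (by norm_num) (by norm_num) (by norm_num)
  rw [integral_add (hint.const_mul _) (integrable_const _), integral_const_mul] at hle
  simp only [integral_const, probReal_univ, one_smul] at hle
  norm_num at hle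
  linarith

end ConvexOnSimplex

section Wasserstein

open Filter Topology

lemma le_map_csInf {S : Set ℝ} (hne : S.Nonempty) (hbdd : BddBelow S) {g : ℝ → ℝ}
    (hg : Continuous g) {a : ℝ} (h : ∀ c ∈ S, a ≤ g c) : a ≤ g (sInf S) :=
  closure_minimal (t := {c | a ≤ g c}) h (isClosed_le continuous_const hg)
    (csInf_mem_closure hne hbdd)

lemma MeasureTheory.MemLp.integral_norm_rpow_rpow_inv {α E : Type*} [MeasurableSpace α]
    [NormedAddCommGroup E] {ρ : Measure α} {f : α → E} (hq : 0 < q)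
    (hf : MemLp f (ENNReal.ofReal q) ρ) :
    (∫ a, ‖f a‖ ^ q ∂ρ) ^ q⁻¹ = (eLpNorm f (ENNReal.ofReal q) ρ).toReal := by
  rw [hf.eLpNorm_eq_integral_rpow_norm (by simpa using hq) ENNReal.ofReal_ne_top,
    ENNReal.toReal_ofReal hq.le, ENNReal.toReal_ofReal (by positivity)]

lemma MeasureTheory.MemLp.integrable_norm_ofReal_rpow {α E : Type*} [MeasurableSpace α]
    [NormedAddCommGroup E] {ρ : Measure α} {f : α → E} (hq : 0 < q)
    (hf : MemLp f (ENNReal.ofReal q) ρ) : Integrable (fun a => ‖f a‖ ^ q) ρ := by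
  have := (integrable_norm_rpow_iff hf.1 (by simpa using hq) ENNReal.ofReal_ne_top).2 hf
  rwa [ENNReal.toReal_ofReal hq.le] at this

lemma isProbabilityMeasure_sum_smul_dirac {ι β : Type*} [Fintype ι] [MeasurableSpace β]
    (x : ι → β) {w : ι → ℝ}
    (hw : w ∈ stdSimplex ℝ ι) :
    IsProbabilityMeasure (∑ i, ENNReal.ofReal (w i) • Measure.dirac (x i)) := by
  refine ⟨?_⟩
  rw [Measure.finsetSum_apply]
  simp [← ENNReal.ofReal_sum_of_nonneg fun i _ => hw.1 i, hw.2]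

lemma measureReal_preimage_mem_stdSimplex {α β : Type*} [MeasurableSpace α] (ρ : Measure α)
    [IsProbabilityMeasure ρ] (f : SimpleFunc α β) :
    (fun i : f.range => ρ.real (f ⁻¹' {i.1})) ∈ stdSimplex ℝ f.range := by
  refine ⟨fun i => measureReal_nonneg, ?_⟩
  rw [Finset.sum_coe_sort f.range (fun i => ρ.real (f ⁻¹' {i}))]
  simp only [measureReal_def]
  rw [← ENNReal.toReal_sum fun i _ => measure_ne_top _ _, f.sum_range_measure_preimage_singleton]
  simp

lemma map_simpleFunc_eq_sum_smul_dirac {α β : Type*} [MeasurableSpace α] [MeasurableSpace β]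
    (ρ : Measure α)
    [IsProbabilityMeasure ρ] (f : SimpleFunc α β) :
    ρ.map f = ∑ i : f.range, ENNReal.ofReal (ρ.real (f ⁻¹' {i.1})) • Measure.dirac i.1 := by
  ext s hs
  rw [Measure.map_apply f.measurable hs, Measure.finsetSum_apply]
  simp only [measureReal_def, ENNReal.ofReal_toReal (measure_ne_top _ _), Measure.smul_apply,
    Measure.dirac_apply' _ hs, smul_eq_mul]
  rw [Finset.sum_coe_sort f.range (fun i => ρ (f ⁻¹' {i}) * s.indicator 1 i)]
  have h1 := (f.map (s.indicator (1 : β → ENNReal))).lintegral_eq_lintegral ρ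
  rw [SimpleFunc.map_lintegral] at h1
  simp only [mul_comm (ρ _), ← h1, SimpleFunc.coe_map]
  rw [← lintegral_indicator_one (f.measurable hs)]
  rfl

variable {K : Type*} [NormedAddCommGroup K] [MeasurableSpace K] {q : ℝ} {μ ν : Measure K}

lemma bddBelow_transportCosts : BddBelow {x | ∃ π : Measure (K × K), IsProbabilityMeasure π ∧
    π.map Prod.fst = μ ∧ π.map Prod.snd = ν ∧ x = ∫ p, ‖p.1 - p.2‖ ^ q ∂π} := by
  refine ⟨0, ?_⟩
  rintro x ⟨π, -, -, -, rfl⟩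
  positivity

lemma memLp_fst_sub_snd [SecondCountableTopology K] [BorelSpace K] {π : Measure (K × K)}
    (h₁ : MemLp id (ENNReal.ofReal q) (π.map Prod.fst))
    (h₂ : MemLp id (ENNReal.ofReal q) (π.map Prod.snd)) :
    MemLp (fun p : K × K => p.1 - p.2) (ENNReal.ofReal q) π := by
  rw [memLp_map_measure_iff (by fun_prop) (by fun_prop)] at h₁ h₂
  exact h₁.sub h₂

lemma memLp_id_sum_smul_dirac [SecondCountableTopology K] [BorelSpace K] {ι : Type*} [Fintype ι] (x : ι → K)
    (w : ι → ℝ) :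
    MemLp id (ENNReal.ofReal q) (∑ i, ENNReal.ofReal (w i) • Measure.dirac (x i)) := by
  have : IsFiniteMeasure (∑ i, ENNReal.ofReal (w i) • Measure.dirac (x i)) :=
    ⟨by simp [Measure.finsetSum_apply]⟩
  refine MemLp.of_bound (by fun_prop) (∑ i, ‖x i‖) ?_
  rw [ae_iff, Measure.finsetSum_apply]
  refine Finset.sum_eq_zero fun i _ => ?_
  have hi : ‖x i‖ ≤ ∑ j, ‖x j‖ :=
    Finset.single_le_sum (fun j _ => norm_nonneg (x j)) (Finset.mem_univ i)
  simp [hi]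

/-- Gluing of couplings along a common marginal. -/
lemma exists_gluing [CompleteSpace K] [SecondCountableTopology K] [BorelSpace K]
    (π₁ π₂ : Measure (K × K)) [IsProbabilityMeasure π₁]
    [IsProbabilityMeasure π₂] (h : π₁.map Prod.snd = π₂.map Prod.fst) :
    ∃ γ : Measure (K × K × K), IsProbabilityMeasure γ ∧
      γ.map (fun p => (p.2.1, p.1)) = π₁ ∧ γ.map (fun p => (p.1, p.2.2)) = π₂ := by
  set π₁' := π₁.map Prod.swap with hπ₁'
  have : IsProbabilityMeasure π₁' := Measure.isProbabilityMeasure_map (by fun_prop)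
  have hfst : π₁'.fst = π₂.fst := by
    rw [Measure.fst, Measure.fst, ← h, hπ₁', Measure.map_map (by fun_prop) (by fun_prop)]
    rfl
  refine ⟨π₂.fst ⊗ₘ (π₁'.condKernel ×ₖ π₂.condKernel), inferInstance, ?_, ?_⟩
  · have h1 : (π₂.fst ⊗ₘ (π₁'.condKernel ×ₖ π₂.condKernel)).map (Prod.map id Prod.fst) = π₁' := by
      rw [← Measure.compProd_map measurable_fst, ← Kernel.fst_eq, Kernel.fst_prod, ← hfst,
        π₁'.disintegrate]
    have h2 : π₁'.map Prod.swap = π₁ := by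
      rw [hπ₁', Measure.map_map (by fun_prop) (by fun_prop)]
      simp
    conv_rhs => rw [← h2, ← h1, Measure.map_map (by fun_prop) (by fun_prop)]
    rfl
  · have h1 : (π₂.fst ⊗ₘ (π₁'.condKernel ×ₖ π₂.condKernel)).map (Prod.map id Prod.snd) = π₂ := by
      rw [← Measure.compProd_map measurable_snd, ← Kernel.snd_eq, Kernel.snd_prod,
        π₂.disintegrate]
    exact h1

variable [InnerProductSpace ℝ K]

lemma WqPow_nonneg : 0 ≤ WqPow q μ ν := by
  refine Real.sInf_nonneg ?_
  rintro x ⟨π, -, -, -, rfl⟩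
  positivity

lemma WqPow_le_integral (π : Measure (K × K)) [hπ : IsProbabilityMeasure π]
    (h₁ : π.map Prod.fst = μ) (h₂ : π.map Prod.snd = ν) :
    WqPow q μ ν ≤ ∫ p, ‖p.1 - p.2‖ ^ q ∂π :=
  csInf_le bddBelow_transportCosts ⟨π, hπ, h₁, h₂, rfl⟩

lemma le_map_WqPow [IsProbabilityMeasure μ] [IsProbabilityMeasure ν] {g : ℝ → ℝ}
    (hg : Continuous g) {a : ℝ}
    (h : ∀ π : Measure (K × K), IsProbabilityMeasure π → π.map Prod.fst = μ →
      π.map Prod.snd = ν → a ≤ g (∫ p, ‖p.1 - p.2‖ ^ q ∂π)) : a ≤ g (WqPow q μ ν) := by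
  refine le_map_csInf ?_ bddBelow_transportCosts hg ?_
  · exact ⟨_, μ.prod ν, inferInstance, by simp, by simp, rfl⟩
  · rintro x ⟨π, hπ, h₁, h₂, rfl⟩
    exact h π hπ h₁ h₂

lemma WqPow_le_two_rpow_mul [IsProbabilityMeasure μ] [IsProbabilityMeasure ν] (hq : 1 ≤ q)
    (hμ : MemLp id (ENNReal.ofReal q) μ) (hν : MemLp id (ENNReal.ofReal q) ν) :
    WqPow q μ ν ≤ 2 ^ (q - 1) * (∫ x, ‖x‖ ^ q ∂μ + ∫ y, ‖y‖ ^ q ∂ν) := by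
  have hq0 : 0 < q := by linarith
  have hI := hμ.integrable_norm_ofReal_rpow hq0
  have hI' := hν.integrable_norm_ofReal_rpow hq0
  refine (WqPow_le_integral (μ.prod ν) (by simp) (by simp)).trans ?_
  have hle : ∀ p : K × K, ‖p.1 - p.2‖ ^ q ≤ 2 ^ (q - 1) * (‖p.1‖ ^ q + ‖p.2‖ ^ q) := by
    intro p
    have h := NNReal.rpow_add_le_mul_rpow_add_rpow ‖p.1‖₊ ‖p.2‖₊ hq
    exact (Real.rpow_le_rpow (norm_nonneg _) (norm_sub_le _ _) hq0.le).trans (mod_cast h)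
  have i1 : Integrable (fun p : K × K => ‖p.1‖ ^ q) (μ.prod ν) := hI.comp_fst ν
  have i2 : Integrable (fun p : K × K => ‖p.2‖ ^ q) (μ.prod ν) := hI'.comp_snd μ
  refine (integral_mono_of_nonneg (Eventually.of_forall fun p => by positivity)
    ((i1.add i2).const_mul _) (Eventually.of_forall hle)).trans_eq ?_
  simp only [Pi.add_apply]
  rw [integral_const_mul, integral_add i1 i2, integral_fun_fst (fun x : K => ‖x‖ ^ q),
    integral_fun_snd (fun x : K => ‖x‖ ^ q)]
  simp

variable [SecondCountableTopology K] [BorelSpace K]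

/-- If the transport cost `W_q(μ, ν)^q` is nonzero then both measures have a `q`-th moment: otherwise
the product coupling has a non-integrable cost, whose Bochner integral is zero. -/
lemma memLp_id_of_WqPow_ne_zero [IsProbabilityMeasure μ] [IsProbabilityMeasure ν] (hq : 0 < q)
    (h : WqPow q μ ν ≠ 0) :
    MemLp id (ENNReal.ofReal q) μ ∧ MemLp id (ENNReal.ofReal q) ν := by
  have hint : Integrable (fun p : K × K => ‖p.1 - p.2‖ ^ q) (μ.prod ν) := by
    by_contra hni
    refine h (le_antisymm ?_ WqPow_nonneg)
    have := WqPow_le_integral (q := q) (μ := μ) (ν := ν) (μ.prod ν) (by simp) (by simp)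
    rwa [integral_undef hni] at this
  have key : ∀ {ρ : Measure K} [IsProbabilityMeasure ρ] (y : K),
      Integrable (fun x => ‖x - y‖ ^ q) ρ → MemLp id (ENNReal.ofReal q) ρ := by
    intro ρ _ y hy
    have h1 : MemLp (fun x => x - y) (ENNReal.ofReal q) ρ := by
      rw [← integrable_norm_rpow_iff (by fun_prop) (by simpa using hq) ENNReal.ofReal_ne_top,
        ENNReal.toReal_ofReal hq.le]
      exact hy
    have h2 := h1.add (memLp_const y)
    convert h2 using 1
    ext x
    simp
  constructor
  · obtain ⟨y, hy⟩ := hint.prod_left_ae.exists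
    exact key y hy
  · obtain ⟨x, hx⟩ := hint.prod_right_ae.exists
    exact key x (by simpa only [norm_sub_rev] using hx)

/-- Triangle inequality for the `q`-Wasserstein distance. -/
lemma WqPow_rpow_inv_triangle [CompleteSpace K] {μ₁ μ₂ μ₃ : Measure K} [IsProbabilityMeasure μ₁]
    [IsProbabilityMeasure μ₂] [IsProbabilityMeasure μ₃] (hq : 1 ≤ q)
    (h₁ : MemLp id (ENNReal.ofReal q) μ₁) (h₂ : MemLp id (ENNReal.ofReal q) μ₂)
    (h₃ : MemLp id (ENNReal.ofReal q) μ₃) :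
    WqPow q μ₁ μ₃ ^ q⁻¹ ≤ WqPow q μ₁ μ₂ ^ q⁻¹ + WqPow q μ₂ μ₃ ^ q⁻¹ := by
  have hq0 : 0 < q := by linarith
  have hcont : Continuous fun c : ℝ => c ^ q⁻¹ :=
    Real.continuous_rpow_const (inv_nonneg.2 hq0.le)
  refine le_map_WqPow (g := fun c => WqPow q μ₁ μ₂ ^ q⁻¹ + c ^ q⁻¹) (by fun_prop) ?_
  intro π₂ hπ₂ h21 h22
  refine le_map_WqPow (g := fun c => c ^ q⁻¹ + (∫ p, ‖p.1 - p.2‖ ^ q ∂π₂) ^ q⁻¹) (by fun_prop) ?_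
  intro π₁ hπ₁ h11 h12
  obtain ⟨γ, hγ, hγ₁, hγ₂⟩ := exists_gluing π₁ π₂ (h12.trans h21.symm)
  have hL₁ : MemLp (fun p : K × K => p.1 - p.2) (ENNReal.ofReal q) π₁ :=
    memLp_fst_sub_snd (h11 ▸ h₁) (h12 ▸ h₂)
  have hL₂ : MemLp (fun p : K × K => p.1 - p.2) (ENNReal.ofReal q) π₂ :=
    memLp_fst_sub_snd (h21 ▸ h₂) (h22 ▸ h₃)
  rw [hL₁.integral_norm_rpow_rpow_inv hq0, hL₂.integral_norm_rpow_rpow_inv hq0]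
  have hM₁ : MemLp (fun p : K × K × K => p.2.1 - p.1) (ENNReal.ofReal q) γ := by
    rw [← hγ₁, memLp_map_measure_iff (by fun_prop) (by fun_prop)] at hL₁
    exact hL₁
  have hM₂ : MemLp (fun p : K × K × K => p.1 - p.2.2) (ENNReal.ofReal q) γ := by
    rw [← hγ₂, memLp_map_measure_iff (by fun_prop) (by fun_prop)] at hL₂
    exact hL₂
  have e₁ : eLpNorm (fun p : K × K => p.1 - p.2) (ENNReal.ofReal q) π₁
      = eLpNorm (fun p : K × K × K => p.2.1 - p.1) (ENNReal.ofReal q) γ := by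
    rw [← hγ₁, eLpNorm_map_measure (by fun_prop) (by fun_prop)]
    rfl
  have e₂ : eLpNorm (fun p : K × K => p.1 - p.2) (ENNReal.ofReal q) π₂
      = eLpNorm (fun p : K × K × K => p.1 - p.2.2) (ENNReal.ofReal q) γ := by
    rw [← hγ₂, eLpNorm_map_measure (by fun_prop) (by fun_prop)]
    rfl
  rw [e₁, e₂, ← ENNReal.toReal_add hM₁.2.ne hM₂.2.ne]
  have hsum : MemLp (fun p : K × K × K => p.2.1 - p.2.2) (ENNReal.ofReal q) γ := by
    convert hM₁.add hM₂ using 1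
    ext p
    simp
  have hmink := eLpNorm_add_le hM₁.1 hM₂.1 (p := ENNReal.ofReal q) (by simpa using hq)
  have hfun : (fun p : K × K × K => p.2.1 - p.1) + (fun p : K × K × K => p.1 - p.2.2)
      = fun p => p.2.1 - p.2.2 := by
    ext p
    simp
  rw [hfun] at hmink
  refine le_trans ?_ (ENNReal.toReal_mono (ENNReal.add_ne_top.2 ⟨hM₁.2.ne, hM₂.2.ne⟩) hmink)
  rw [← hsum.integral_norm_rpow_rpow_inv hq0]
  refine Real.rpow_le_rpow WqPow_nonneg ?_ (inv_nonneg.2 hq0.le)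
  have hprob : IsProbabilityMeasure (γ.map Prod.snd) :=
    Measure.isProbabilityMeasure_map (by fun_prop)
  have := WqPow_le_integral (q := q) (μ := μ₁) (ν := μ₃) (γ.map Prod.snd) ?_ ?_
  · rwa [integral_map (by fun_prop) (by fun_prop (disch := exact hq0.le))] at this
  · rw [← h11, ← hγ₁, Measure.map_map (by fun_prop) (by fun_prop),
      Measure.map_map (by fun_prop) (by fun_prop)]
    rfl
  · rw [← h22, ← hγ₂, Measure.map_map (by fun_prop) (by fun_prop),
      Measure.map_map (by fun_prop) (by fun_prop)]
    rfl

lemma WqPow_map_rpow_inv_le [IsProbabilityMeasure μ] (hq : 1 ≤ q) {f g : K → K} (hf : Measurable f)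
    (hg : Measurable g) (hfg : MemLp (f - g) (ENNReal.ofReal q) μ) :
    WqPow q (μ.map f) (μ.map g) ^ q⁻¹ ≤ (eLpNorm (f - g) (ENNReal.ofReal q) μ).toReal := by
  have hq0 : 0 < q := by linarith
  rw [← hfg.integral_norm_rpow_rpow_inv hq0]
  refine Real.rpow_le_rpow WqPow_nonneg ?_ (inv_nonneg.2 hq0.le)
  have hprob : IsProbabilityMeasure (μ.map fun x => (f x, g x)) :=
    Measure.isProbabilityMeasure_map (by fun_prop)
  have := WqPow_le_integral (q := q) (μ := μ.map f) (ν := μ.map g) (μ.map fun x => (f x, g x)) ?_ ?_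
  · rwa [integral_map (by fun_prop) (by fun_prop (disch := exact hq0.le))] at this
  · rw [Measure.map_map (by fun_prop) (by fun_prop)]
    rfl
  · rw [Measure.map_map (by fun_prop) (by fun_prop)]
    rfl

/-- Convexity of the transport cost in its first argument. -/
lemma WqPow_convex_combination_le {μ' : Measure K} [IsProbabilityMeasure μ] [IsProbabilityMeasure μ']
    [IsProbabilityMeasure ν] (hq : 1 ≤ q) (hμ : MemLp id (ENNReal.ofReal q) μ)
    (hμ' : MemLp id (ENNReal.ofReal q) μ') (hν : MemLp id (ENNReal.ofReal q) ν) {a b : ℝ}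
    (ha : 0 ≤ a) (hb : 0 ≤ b) (hab : a + b = 1) :
    WqPow q (ENNReal.ofReal a • μ + ENNReal.ofReal b • μ') ν
      ≤ a * WqPow q μ ν + b * WqPow q μ' ν := by
  have hq0 : 0 < q := by linarith
  have hab' : ENNReal.ofReal a + ENNReal.ofReal b = 1 := by
    rw [← ENNReal.ofReal_add ha hb, hab, ENNReal.ofReal_one]
  refine le_map_WqPow (g := fun c => a * WqPow q μ ν + b * c) (by fun_prop) ?_
  intro π' hπ' h1' h2'
  refine le_map_WqPow (g := fun c => a * c + b * (∫ p, ‖p.1 - p.2‖ ^ q ∂π')) (by fun_prop) ?_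
  intro π hπ h1 h2
  have hI : Integrable (fun p : K × K => ‖p.1 - p.2‖ ^ q) π :=
    (memLp_fst_sub_snd (h1 ▸ hμ) (h2 ▸ hν)).integrable_norm_ofReal_rpow hq0
  have hI' : Integrable (fun p : K × K => ‖p.1 - p.2‖ ^ q) π' :=
    (memLp_fst_sub_snd (h1' ▸ hμ') (h2' ▸ hν)).integrable_norm_ofReal_rpow hq0
  have hprob : IsProbabilityMeasure (ENNReal.ofReal a • π + ENNReal.ofReal b • π') :=
    ⟨by simp [hab']⟩
  have := WqPow_le_integral (q := q) (μ := ENNReal.ofReal a • μ + ENNReal.ofReal b • μ') (ν := ν)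
    (ENNReal.ofReal a • π + ENNReal.ofReal b • π') ?_ ?_
  · rwa [integral_add_measure (hI.smul_measure ENNReal.ofReal_ne_top)
      (hI'.smul_measure ENNReal.ofReal_ne_top), integral_smul_measure, integral_smul_measure,
      ENNReal.toReal_ofReal ha, ENNReal.toReal_ofReal hb, smul_eq_mul, smul_eq_mul] at this
  · rw [Measure.map_add _ _ measurable_fst, Measure.map_smul, Measure.map_smul, h1, h1']
  · rw [Measure.map_add _ _ measurable_snd, Measure.map_smul, Measure.map_smul, h2, h2',
      ← add_smul, hab', one_smul]

lemma convexOn_WqPow_sum_smul_dirac [IsProbabilityMeasure ν] (hq : 1 ≤ q)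
    (hν : MemLp id (ENNReal.ofReal q) ν) {ι : Type*} [Fintype ι] (x : ι → K) :
    ConvexOn ℝ (stdSimplex ℝ ι)
      (fun w => WqPow q (∑ i, ENNReal.ofReal (w i) • Measure.dirac (x i)) ν) := by
  refine ⟨convex_stdSimplex ℝ ι, fun w hw v hv a b ha hb hab => ?_⟩
  have := isProbabilityMeasure_sum_smul_dirac x hw
  have := isProbabilityMeasure_sum_smul_dirac x hv
  have hsum : ∑ i, ENNReal.ofReal ((a • w + b • v) i) • Measure.dirac (x i)
      = ENNReal.ofReal a • ∑ i, ENNReal.ofReal (w i) • Measure.dirac (x i)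
        + ENNReal.ofReal b • ∑ i, ENNReal.ofReal (v i) • Measure.dirac (x i) := by
    simp only [Finset.smul_sum, ← Finset.sum_add_distrib, smul_smul, ← add_smul]
    refine Finset.sum_congr rfl fun i _ => ?_
    rw [← ENNReal.ofReal_mul ha, ← ENNReal.ofReal_mul hb,
      ← ENNReal.ofReal_add (mul_nonneg ha (hw.1 i)) (mul_nonneg hb (hv.1 i))]
    rfl
  beta_reduce
  rw [hsum]
  exact WqPow_convex_combination_le hq (memLp_id_sum_smul_dirac x w)
    (memLp_id_sum_smul_dirac x v) hν ha hb hab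

section Kernel

variable {𝒰 : Type*} [MeasurableSpace 𝒰] {ρ : Measure 𝒰} {κ : Kernel 𝒰 K}

lemma measurable_WqPow_map_simpleFunc [IsMarkovKernel κ] [IsProbabilityMeasure ν] (hq : 1 ≤ q)
    (hν : MemLp id (ENNReal.ofReal q) ν) (f : SimpleFunc K K) :
    Measurable fun u => WqPow q ((κ u).map f) ν := by
  simp only [map_simpleFunc_eq_sum_smul_dirac]
  refine (convexOn_WqPow_sum_smul_dirac hq hν
    (Subtype.val : f.range → K)).measurable_comp_of_mem_stdSimplex (fun w => WqPow_nonneg) (w := fun u (i : f.range) => (κ u).real (f ⁻¹' {i.1})) ?_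
    fun u => measureReal_preimage_mem_stdSimplex (κ u) f
  exact measurable_pi_lambda _ fun i =>
    (Kernel.measurable_coe κ (f.measurableSet_fiber i.1)).ennreal_toReal

/-- The gluing inequality after discretizing the first marginal. -/
lemma WqPow_map_simpleFunc_le_integral [IsProbabilityMeasure ρ] [IsMarkovKernel κ]
    [IsProbabilityMeasure ν] (hq : 1 ≤ q) (hν : MemLp id (ENNReal.ofReal q) ν)
    (f : SimpleFunc K K) :
    WqPow q ((κ ∘ₘ ρ).map f) ν ≤ ∫ u, WqPow q ((κ u).map f) ν ∂ρ := by
  have hmeas : ∀ i : f.range, Measurable fun u => κ u (f ⁻¹' {i.1}) :=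
    fun i => Kernel.measurable_coe κ (f.measurableSet_fiber i.1)
  have hmean : (fun i : f.range => (κ ∘ₘ ρ).real (f ⁻¹' {i.1}))
      = ∫ u, (fun i : f.range => (κ u).real (f ⁻¹' {i.1})) ∂ρ := by
    ext i
    rw [eval_integral fun i => ?_]
    · simp only [measureReal_def]
      rw [integral_toReal (hmeas i).aemeasurable (Eventually.of_forall fun u => measure_lt_top _ _),
        Measure.bind_apply (f.measurableSet_fiber i.1) κ.aemeasurable]
    · refine Integrable.of_bound (hmeas i).ennreal_toReal.aestronglyMeasurable 1
        (Eventually.of_forall fun u => ?_)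
      rw [Real.norm_of_nonneg measureReal_nonneg]
      exact measureReal_le_one
  have hJ := (convexOn_WqPow_sum_smul_dirac hq hν
    (Subtype.val : f.range → K)).map_integral_le_of_mem_stdSimplex (ρ := ρ)
    (fun w => WqPow_nonneg) (w := fun u (i : f.range) => (κ u).real (f ⁻¹' {i.1}))
    (measurable_pi_lambda _ fun i => (hmeas i).ennreal_toReal)
    fun u => measureReal_preimage_mem_stdSimplex (κ u) f
  rw [← hmean] at hJ
  simpa only [map_simpleFunc_eq_sum_smul_dirac] using hJ

end Kernel

lemma tendsto_WqPow_map [CompleteSpace K] [IsProbabilityMeasure μ] [IsProbabilityMeasure ν]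
    (hq : 1 ≤ q) (hμ : MemLp id (ENNReal.ofReal q) μ) (hν : MemLp id (ENNReal.ofReal q) ν)
    {f : ℕ → K → K} (hf : ∀ n, Measurable (f n)) (hfm : ∀ n, MemLp (f n) (ENNReal.ofReal q) μ)
    (hlim : Tendsto (fun n => eLpNorm (f n - id) (ENNReal.ofReal q) μ) atTop (𝓝 0)) :
    Tendsto (fun n => WqPow q (μ.map (f n)) ν) atTop (𝓝 (WqPow q μ ν)) := by
  have hq0 : 0 < q := by linarith
  have hroot : Tendsto (fun n => WqPow q (μ.map (f n)) ν ^ q⁻¹) atTop (𝓝 (WqPow q μ ν ^ q⁻¹)) := by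
    have hlim' := (ENNReal.tendsto_toReal ENNReal.zero_ne_top).comp hlim
    rw [ENNReal.toReal_zero] at hlim'
    refine tendsto_iff_dist_tendsto_zero.2 (squeeze_zero (fun _ => dist_nonneg) (fun n => ?_) hlim')
    have hp : IsProbabilityMeasure (μ.map (f n)) :=
      Measure.isProbabilityMeasure_map (hf n).aemeasurable
    have hfn : MemLp id (ENNReal.ofReal q) (μ.map (f n)) :=
      (memLp_map_measure_iff (by fun_prop) (hf n).aemeasurable).2 (hfm n)
    have t1 := WqPow_rpow_inv_triangle hq hfn hμ hν
    have t2 := WqPow_rpow_inv_triangle hq hμ hfn hν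
    have d1 := WqPow_map_rpow_inv_le hq (hf n) measurable_id ((hfm n).sub hμ)
    have d2 := WqPow_map_rpow_inv_le hq measurable_id (hf n) (hμ.sub (hfm n))
    rw [eLpNorm_sub_comm] at d2
    rw [Measure.map_id] at d1 d2
    rw [Real.dist_eq, abs_le]
    simp only [Function.comp_apply]
    constructor <;> linarith
  have h := (Real.continuous_rpow_const hq0.le).continuousAt.tendsto.comp hroot
  simpa only [Function.comp_def, Real.rpow_inv_rpow WqPow_nonneg hq0.ne'] using h

/-- The transport cost of a mixture is at most the average of the transport costs of its
components. -/
lemma WqPow_comp_le_integral [CompleteSpace K] {𝒰 : Type*} [MeasurableSpace 𝒰] {ρ : Measure 𝒰}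
    {κ : Kernel 𝒰 K} [IsProbabilityMeasure ρ] [IsMarkovKernel κ] [IsProbabilityMeasure ν]
    (hq : 1 ≤ q) : WqPow q (κ ∘ₘ ρ) ν ≤ ∫ u, WqPow q (κ u) ν ∂ρ := by
  have hq0 : 0 < q := by linarith
  rcases eq_or_ne (WqPow q (κ ∘ₘ ρ) ν) 0 with h0 | h0
  · rw [h0]
    exact integral_nonneg fun u => WqPow_nonneg
  obtain ⟨hμ, hν⟩ := memLp_id_of_WqPow_ne_zero hq0 h0
  set f : ℕ → SimpleFunc K K :=
    fun n => SimpleFunc.approxOn id measurable_id Set.univ 0 (Set.mem_univ _) n with hf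
  have hfm : ∀ {μ : Measure K}, MemLp id (ENNReal.ofReal q) μ → ∀ n,
      MemLp (f n) (ENNReal.ofReal q) μ := fun h n =>
    SimpleFunc.memLp_approxOn measurable_id h (Set.mem_univ _) MemLp.zero n
  have hlim : ∀ {μ : Measure K} [IsProbabilityMeasure μ], MemLp id (ENNReal.ofReal q) μ →
      Tendsto (fun n => WqPow q (μ.map (f n)) ν) atTop (𝓝 (WqPow q μ ν)) := by
    intro μ _ h
    refine tendsto_WqPow_map hq h hν (fun n => (f n).measurable) (hfm h) ?_
    exact SimpleFunc.tendsto_approxOn_Lp_eLpNorm measurable_id (Set.mem_univ _)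
      ENNReal.ofReal_ne_top (by simp) (by simpa using! h.2)
  have hint := hμ.integrable_norm_ofReal_rpow hq0
  have hae : ∀ᵐ u ∂ρ, MemLp id (ENNReal.ofReal q) (κ u) := by
    filter_upwards [Measure.ae_integrable_of_integrable_comp hint] with u hu
    rw [← integrable_norm_rpow_iff (by fun_prop) (by simpa using hq0) ENNReal.ofReal_ne_top,
      ENNReal.toReal_ofReal hq0.le]
    exact hu
  have hmoment : Integrable (fun u => ∫ x, ‖x‖ ^ q ∂κ u) ρ := by
    refine (Measure.integrable_integral_norm_of_integrable_comp hint).congr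
      (Eventually.of_forall fun u => integral_congr_ae (Eventually.of_forall fun x => ?_))
    simp only [id_eq]
    rw [Real.norm_of_nonneg (by positivity)]
  refine le_of_tendsto_of_tendsto' (hlim hμ) (tendsto_integral_of_dominated_convergence
    (fun u => 2 ^ (q - 1) * (2 ^ q * (∫ x, ‖x‖ ^ q ∂κ u) + ∫ y, ‖y‖ ^ q ∂ν))
    (fun n => (measurable_WqPow_map_simpleFunc hq hν (f n)).aestronglyMeasurable)
    (((hmoment.const_mul _).add (integrable_const _)).const_mul _) (fun n => ?_)
    (hae.mono fun u hu => hlim hu)) fun n => WqPow_map_simpleFunc_le_integral hq hν (f n)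
  filter_upwards [hae] with u hu
  have hp : IsProbabilityMeasure ((κ u).map (f n)) :=
    Measure.isProbabilityMeasure_map (f n).measurable.aemeasurable
  have hfn : MemLp id (ENNReal.ofReal q) ((κ u).map (f n)) :=
    (memLp_map_measure_iff (by fun_prop) (f n).measurable.aemeasurable).2 (hfm hu n)
  rw [Real.norm_of_nonneg WqPow_nonneg]
  refine (WqPow_le_two_rpow_mul hq hfn hν).trans ?_
  gcongr
  rw [integral_map (f n).measurable.aemeasurable (by fun_prop (disch := exact hq0.le)),
    ← integral_const_mul]
  refine integral_mono_of_nonneg (Eventually.of_forall fun x => by positivity)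
    ((hu.integrable_norm_ofReal_rpow hq0).const_mul _) (Eventually.of_forall fun x => ?_)
  simp only
  rw [← Real.mul_rpow zero_le_two (norm_nonneg x), two_mul]
  exact Real.rpow_le_rpow (norm_nonneg _)
    (SimpleFunc.norm_approxOn_zero_le measurable_id (Set.mem_univ _) x n) hq0.le

end Wasserstein

/-- **Conditional coupling (gluing) inequality for Wasserstein distances.**
Let `K` be a separable real Hilbert space, `X, Y` be `K`-valued random elements and `U` a
random element with values in a Polish space `𝒰` defined on the same probability space as
`X`. Then for every `q ≥ 1` there is a (Markov-kernel) version `κ` of the conditional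
distribution of `X` given `U` such that
`W_q(X, Y)^q ≤ ∫ W_q(κ u, law Y)^q d(law U)(u)`. -/
theorem wasserstein_conditional_coupling
    {Ω : Type*} [MeasurableSpace Ω] (P : Measure Ω) [IsProbabilityMeasure P]
    {K : Type*} [NormedAddCommGroup K] [InnerProductSpace ℝ K] [CompleteSpace K]
    [SecondCountableTopology K] [MeasurableSpace K] [BorelSpace K]
    {𝒰 : Type*} [TopologicalSpace 𝒰] [PolishSpace 𝒰] [MeasurableSpace 𝒰] [BorelSpace 𝒰]
    (X Y : Ω → K) (U : Ω → 𝒰) (hX : Measurable X) (hY : Measurable Y) (hU : Measurable U)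
    (q : ℝ) (hq : 1 ≤ q) :
    ∃ κ : ProbabilityTheory.Kernel 𝒰 K, IsMarkovKernel κ ∧
      P.map (fun ω => (U ω, X ω)) = (P.map U).compProd κ ∧
      WqPow q (P.map X) (P.map Y) ≤ ∫ u, WqPow q (κ u) (P.map Y) ∂(P.map U) := by
  have : IsProbabilityMeasure (P.map U) := Measure.isProbabilityMeasure_map hU.aemeasurable
  have : IsProbabilityMeasure (P.map Y) := Measure.isProbabilityMeasure_map hY.aemeasurable
  have hdis := compProd_map_condDistrib (mβ := inferInstance) (X := U) (μ := P) hX.aemeasurable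
  refine ⟨condDistrib X U P, inferInstance, hdis.symm, ?_⟩
  have hcomp : condDistrib X U P ∘ₘ P.map U = P.map X := by
    rw [← Measure.snd_compProd, hdis, Measure.snd_map_prodMk hU]
  rw [← hcomp]
  exact WqPow_comp_le_integral hq
end
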